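/- Inferred types are principal: if ⊢ Γ and Γ ⊢ t ▹ T is derivable in the cumulative bidirectional system, then T is a principal type for t in Γ, i.e. Γ ⊢ t : T holds in the cumulative undirected system and for every T' with Γ ⊢ t : T' in the cumulative undirected system we have T ≼ T'. -/

import Mathlib

/-! Formalization of CCω (terms, reduction, conversion, undirected and
bidirectional typing, cumulativity) using de Bruijn indices, following
Lennon-Bertrand, "Complete Bidirectional Typing for the Calculus of
Inductive Constructions". -/

namespace CComega

/-- Terms of CCω: `t ::= x | □_i | Πx:t.t | λx:t.t | t t`,
with variables as de Bruijn indices. -/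
inductive Tm : Type
  | var : ℕ → Tm
  | sort : ℕ → Tm
  | pi : Tm → Tm → Tm
  | lam : Tm → Tm → Tm
  | app : Tm → Tm → Tm
deriving DecidableEq

/-- `lift n k t` shifts by `n` the de Bruijn indices of `t` that are ≥ `k`. -/
def lift (n k : ℕ) : Tm → Tm
  | .var i => if i < k then .var i else .var (i + n)
  | .sort i => .sort i
  | .pi A B => .pi (lift n k A) (lift n (k + 1) B)
  | .lam A t => .lam (lift n k A) (lift n (k + 1) t)
  | .app t u => .app (lift n k t) (lift n k u)

/-- `subst u k t` is the capture-avoiding substitution `t[u/k]` of `u`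
for de Bruijn index `k` in `t`. -/
def subst (u : Tm) (k : ℕ) : Tm → Tm
  | .var i => if i < k then .var i else if i = k then lift k 0 u else .var (i - 1)
  | .sort i => .sort i
  | .pi A B => .pi (subst u k A) (subst u (k + 1) B)
  | .lam A t => .lam (subst u k A) (subst u (k + 1) t)
  | .app t v => .app (subst u k t) (subst u k v)

/-- One-step reduction `t → t'`: the least congruence such that
`(λx:A.t) u → t[u/x]`. -/
inductive Red : Tm → Tm → Prop
  | beta (A t u : Tm) : Red (.app (.lam A t) u) (subst u 0 t)
  | piDom {A A'} (B : Tm) : Red A A' → Red (.pi A B) (.pi A' B)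
  | piCod (A : Tm) {B B'} : Red B B' → Red (.pi A B) (.pi A B')
  | lamDom {A A'} (t : Tm) : Red A A' → Red (.lam A t) (.lam A' t)
  | lamBody (A : Tm) {t t'} : Red t t' → Red (.lam A t) (.lam A t')
  | appFun {t t'} (u : Tm) : Red t t' → Red (.app t u) (.app t' u)
  | appArg (t : Tm) {u u'} : Red u u' → Red (.app t u) (.app t u')

/-- Multi-step reduction `t ↠ t'`: reflexive-transitive closure of `→`. -/
def Reds : Tm → Tm → Prop := Relation.ReflTransGen Red

/-- Conversion `t ≡ u`: symmetric, reflexive, transitive closure of `→`. -/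
def Conv : Tm → Tm → Prop := Relation.EqvGen Red

/-- Contexts are lists of (de Bruijn) declarations, most recent first. -/
abbrev Ctx := List Tm

mutual
/-- Context well-formedness `⊢ Γ`. -/
inductive WfCtx : Ctx → Prop
  | nil : WfCtx []
  | cons {Γ A i} : WfCtx Γ → Typed Γ A (.sort i) → WfCtx (A :: Γ)

/-- Undirected typing `Γ ⊢ t : T`. -/
inductive Typed : Ctx → Tm → Tm → Prop
  | sort {Γ i} : WfCtx Γ → Typed Γ (.sort i) (.sort (i + 1))
  | var {Γ n A} : WfCtx Γ → Γ[n]? = some A → Typed Γ (.var n) (lift (n + 1) 0 A)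
  | pi {Γ A B i j} : Typed Γ A (.sort i) → Typed (A :: Γ) B (.sort j) →
      Typed Γ (.pi A B) (.sort (max i j))
  | lam {Γ A B t i} : Typed Γ (.pi A B) (.sort i) → Typed (A :: Γ) t B →
      Typed Γ (.lam A t) (.pi A B)
  | app {Γ t u A B} : Typed Γ t (.pi A B) → Typed Γ u A →
      Typed Γ (.app t u) (subst u 0 B)
  | conv {Γ t A B i} : Typed Γ t A → Typed Γ B (.sort i) → Conv A B →
      Typed Γ t B
end

mutual
/-- Bidirectional inference `Γ ⊢ t ▹ T`. -/
inductive Infer : Ctx → Tm → Tm → Prop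
  | sort {Γ i} : Infer Γ (.sort i) (.sort (i + 1))
  | var {Γ n A} : Γ[n]? = some A → Infer Γ (.var n) (lift (n + 1) 0 A)
  | pi {Γ A B i j} : InferSort Γ A (.sort i) → InferSort (A :: Γ) B (.sort j) →
      Infer Γ (.pi A B) (.sort (max i j))
  | lam {Γ A t B i} : InferSort Γ A (.sort i) → Infer (A :: Γ) t B →
      Infer Γ (.lam A t) (.pi A B)
  | app {Γ t u A B} : InferPi Γ t (.pi A B) → Check Γ u A →
      Infer Γ (.app t u) (subst u 0 B)

/-- Bidirectional checking `Γ ⊢ t ◃ T`. -/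
inductive Check : Ctx → Tm → Tm → Prop
  | check {Γ t T T'} : Infer Γ t T' → Conv T' T → Check Γ t T

/-- Constrained inference `Γ ⊢ t ▹_□ T` (the output is a universe). -/
inductive InferSort : Ctx → Tm → Tm → Prop
  | inferSort {Γ t T i} : Infer Γ t T → Reds T (.sort i) → InferSort Γ t (.sort i)

/-- Constrained inference `Γ ⊢ t ▹_Π T` (the output is a product type). -/
inductive InferPi : Ctx → Tm → Tm → Prop
  | inferPi {Γ t T A B} : Infer Γ t T → Reds T (.pi A B) → InferPi Γ t (.pi A B)
end

/-- Weak-head reduction `t ⇝ t'`: reduction only at the head. -/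
inductive WhRed : Tm → Tm → Prop
  | beta (A t u : Tm) : WhRed (.app (.lam A t) u) (subst u 0 t)
  | appFun {t t'} (u : Tm) : WhRed t t' → WhRed (.app t u) (.app t' u)

/-- Multi-step weak-head reduction `t ⇝* t'`. -/
def WhReds : Tm → Tm → Prop := Relation.ReflTransGen WhRed

mutual
/-- Weak-head bidirectional inference: as `Infer`, but constrained inference
uses weak-head reduction. -/
inductive InferW : Ctx → Tm → Tm → Prop
  | sort {Γ i} : InferW Γ (.sort i) (.sort (i + 1))
  | var {Γ n A} : Γ[n]? = some A → InferW Γ (.var n) (lift (n + 1) 0 A)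
  | pi {Γ A B i j} : InferSortW Γ A (.sort i) → InferSortW (A :: Γ) B (.sort j) →
      InferW Γ (.pi A B) (.sort (max i j))
  | lam {Γ A t B i} : InferSortW Γ A (.sort i) → InferW (A :: Γ) t B →
      InferW Γ (.lam A t) (.pi A B)
  | app {Γ t u A B} : InferPiW Γ t (.pi A B) → CheckW Γ u A →
      InferW Γ (.app t u) (subst u 0 B)

/-- Weak-head bidirectional checking. -/
inductive CheckW : Ctx → Tm → Tm → Prop
  | check {Γ t T T'} : InferW Γ t T' → Conv T' T → CheckW Γ t T

/-- Weak-head constrained inference `Γ ⊢ t ▹_□ T`. -/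
inductive InferSortW : Ctx → Tm → Tm → Prop
  | inferSort {Γ t T i} : InferW Γ t T → WhReds T (.sort i) →
      InferSortW Γ t (.sort i)

/-- Weak-head constrained inference `Γ ⊢ t ▹_Π T`. -/
inductive InferPiW : Ctx → Tm → Tm → Prop
  | inferPi {Γ t T A B} : InferW Γ t T → WhReds T (.pi A B) →
      InferPiW Γ t (.pi A B)
end

/-- Cumulativity `t ≼ u`: the least transitive relation containing conversion
such that `□_i ≼ □_j` whenever `i ≤ j` and `Πx:A.B ≼ Πx:A'.B'` whenever
`A ≡ A'` and `B ≼ B'`. -/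
inductive Cum : Tm → Tm → Prop
  | ofConv {t u} : Conv t u → Cum t u
  | sort {i j : ℕ} : i ≤ j → Cum (.sort i) (.sort j)
  | pi {A A' B B'} : Conv A A' → Cum B B' → Cum (.pi A B) (.pi A' B')
  | trans {t u v} : Cum t u → Cum u v → Cum t v

mutual
/-- Context well-formedness for the cumulative undirected system. -/
inductive WfCtxC : Ctx → Prop
  | nil : WfCtxC []
  | cons {Γ A i} : WfCtxC Γ → TypedC Γ A (.sort i) → WfCtxC (A :: Γ)

/-- Cumulative undirected typing `Γ ⊢ t : T`: as `Typed`, with the conversion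
rule replaced by cumulativity. -/
inductive TypedC : Ctx → Tm → Tm → Prop
  | sort {Γ i} : WfCtxC Γ → TypedC Γ (.sort i) (.sort (i + 1))
  | var {Γ n A} : WfCtxC Γ → Γ[n]? = some A → TypedC Γ (.var n) (lift (n + 1) 0 A)
  | pi {Γ A B i j} : TypedC Γ A (.sort i) → TypedC (A :: Γ) B (.sort j) →
      TypedC Γ (.pi A B) (.sort (max i j))
  | lam {Γ A B t i} : TypedC Γ (.pi A B) (.sort i) → TypedC (A :: Γ) t B →
      TypedC Γ (.lam A t) (.pi A B)
  | app {Γ t u A B} : TypedC Γ t (.pi A B) → TypedC Γ u A →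
      TypedC Γ (.app t u) (subst u 0 B)
  | cumul {Γ t A B i} : TypedC Γ t A → TypedC Γ B (.sort i) → Cum A B →
      TypedC Γ t B
end

mutual
/-- Cumulative bidirectional inference `Γ ⊢ t ▹ T`. -/
inductive InferC : Ctx → Tm → Tm → Prop
  | sort {Γ i} : InferC Γ (.sort i) (.sort (i + 1))
  | var {Γ n A} : Γ[n]? = some A → InferC Γ (.var n) (lift (n + 1) 0 A)
  | pi {Γ A B i j} : InferSortC Γ A (.sort i) → InferSortC (A :: Γ) B (.sort j) →
      InferC Γ (.pi A B) (.sort (max i j))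
  | lam {Γ A t B i} : InferSortC Γ A (.sort i) → InferC (A :: Γ) t B →
      InferC Γ (.lam A t) (.pi A B)
  | app {Γ t u A B} : InferPiC Γ t (.pi A B) → CheckC Γ u A →
      InferC Γ (.app t u) (subst u 0 B)

/-- Cumulative bidirectional checking `Γ ⊢ t ◃ T`, using cumulativity. -/
inductive CheckC : Ctx → Tm → Tm → Prop
  | check {Γ t T T'} : InferC Γ t T' → Cum T' T → CheckC Γ t T

/-- Cumulative constrained inference `Γ ⊢ t ▹_□ T` (unchanged: uses reduction). -/
inductive InferSortC : Ctx → Tm → Tm → Prop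
  | inferSort {Γ t T i} : InferC Γ t T → Reds T (.sort i) → InferSortC Γ t (.sort i)

/-- Cumulative constrained inference `Γ ⊢ t ▹_Π T` (unchanged: uses reduction). -/
inductive InferPiC : Ctx → Tm → Tm → Prop
  | inferPi {Γ t T A B} : InferC Γ t T → Reds T (.pi A B) → InferPiC Γ t (.pi A B)
end

/-! ### Parallel renamings and substitutions -/

/-- Extension of a renaming under a binder. -/
def upRen (ξ : ℕ → ℕ) : ℕ → ℕ
  | 0 => 0
  | n + 1 => ξ n + 1

/-- Parallel renaming. -/
def rename (ξ : ℕ → ℕ) : Tm → Tm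
  | .var i => .var (ξ i)
  | .sort i => .sort i
  | .pi A B => .pi (rename ξ A) (rename (upRen ξ) B)
  | .lam A t => .lam (rename ξ A) (rename (upRen ξ) t)
  | .app t u => .app (rename ξ t) (rename ξ u)

/-- Extension of a substitution under a binder. -/
def up (σ : ℕ → Tm) : ℕ → Tm
  | 0 => .var 0
  | n + 1 => rename Nat.succ (σ n)

/-- Parallel substitution. -/
def inst (σ : ℕ → Tm) : Tm → Tm
  | .var i => σ i
  | .sort i => .sort i
  | .pi A B => .pi (inst σ A) (inst (up σ) B)
  | .lam A t => .lam (inst σ A) (inst (up σ) t)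
  | .app t u => .app (inst σ t) (inst σ u)

/-- The substitution sending index `0` to `u` and `n + 1` to `σ n`. -/
def scons (u : Tm) (σ : ℕ → Tm) : ℕ → Tm
  | 0 => u
  | n + 1 => σ n

theorem upRen_comp (ξ ζ : ℕ → ℕ) : upRen ζ ∘ upRen ξ = upRen (ζ ∘ ξ) := by
  funext i; cases i <;> rfl

theorem rename_rename (ξ ζ : ℕ → ℕ) (t : Tm) :
    rename ζ (rename ξ t) = rename (ζ ∘ ξ) t := by
  induction t generalizing ξ ζ <;> simp_all [rename, upRen_comp]

theorem inst_rename (ξ : ℕ → ℕ) (σ : ℕ → Tm) (t : Tm) :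
    inst σ (rename ξ t) = inst (σ ∘ ξ) t := by
  have h : ∀ (ξ : ℕ → ℕ) (σ : ℕ → Tm), up σ ∘ upRen ξ = up (σ ∘ ξ) := by
    intro ξ σ; funext i; cases i <;> rfl
  induction t generalizing ξ σ <;> simp_all [rename, inst]

theorem rename_inst (σ : ℕ → Tm) (ζ : ℕ → ℕ) (t : Tm) :
    rename ζ (inst σ t) = inst (rename ζ ∘ σ) t := by
  have h : ∀ (ζ : ℕ → ℕ) (σ : ℕ → Tm), rename (upRen ζ) ∘ up σ = up (rename ζ ∘ σ) := by
    intro ζ σ; funext i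
    cases i with
    | zero => rfl
    | succ i => simp only [Function.comp, up, rename_rename]; rfl
  induction t generalizing ζ σ <;> simp_all [rename, inst]

theorem inst_inst (σ τ : ℕ → Tm) (t : Tm) :
    inst τ (inst σ t) = inst (inst τ ∘ σ) t := by
  have h : ∀ σ τ : ℕ → Tm, inst (up τ) ∘ up σ = up (inst τ ∘ σ) := by
    intro σ τ; funext i
    cases i with
    | zero => rfl
    | succ i => simp only [Function.comp, up, rename_inst, inst_rename]; rfl
  induction t generalizing σ τ <;> simp_all [inst]

theorem rename_eq_inst (ξ : ℕ → ℕ) (t : Tm) : rename ξ t = inst (Tm.var ∘ ξ) t := by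
  have h : ∀ ξ : ℕ → ℕ, up (Tm.var ∘ ξ) = Tm.var ∘ upRen ξ := by
    intro ξ; funext i; cases i <;> rfl
  induction t generalizing ξ <;> simp_all [rename, inst]

theorem inst_var (t : Tm) : inst Tm.var t = t := by
  have h : up Tm.var = Tm.var := by funext i; cases i <;> rfl
  induction t <;> simp_all [inst]

theorem lift_eq_rename (n k : ℕ) (t : Tm) :
    lift n k t = rename (fun i => if i < k then i else i + n) t := by
  have h : ∀ k, upRen (fun i => if i < k then i else i + n) =
      fun i => if i < k + 1 then i else i + n := by
    intro k; funext i
    cases i with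
    | zero => simp [upRen]
    | succ i => simp only [upRen]; split_ifs <;> omega
  induction t generalizing k with
  | var i => simp only [lift, rename]; split_ifs <;> rfl
  | _ => simp_all [lift, rename]

theorem lift_zero_eq_rename (n : ℕ) (t : Tm) : lift n 0 t = rename (· + n) t := by
  simp [lift_eq_rename]

theorem rename_succ_lift (n : ℕ) (t : Tm) :
    rename Nat.succ (lift n 0 t) = lift (n + 1) 0 t := by
  simp only [lift_zero_eq_rename, rename_rename]; rfl

theorem rename_upRen_lift_succ (ξ : ℕ → ℕ) (n : ℕ) (t : Tm) :
    rename (upRen ξ) (lift (n + 1) 0 t) = rename Nat.succ (rename ξ (lift n 0 t)) := by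
  rw [← rename_succ_lift, rename_rename, rename_rename]; rfl

theorem inst_up_lift_succ (σ : ℕ → Tm) (n : ℕ) (t : Tm) :
    inst (up σ) (lift (n + 1) 0 t) = rename Nat.succ (inst σ (lift n 0 t)) := by
  rw [← rename_succ_lift, inst_rename, rename_inst]; rfl

theorem lift_zero_zero (t : Tm) : lift 0 0 t = t := by
  have h : (Tm.var ∘ fun i : ℕ => i + 0) = Tm.var := rfl
  rw [lift_zero_eq_rename, rename_eq_inst, h, inst_var]

theorem subst_eq_inst (u : Tm) (k : ℕ) (t : Tm) :
    subst u k t = inst (fun i => if i < k then .var i else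
      if i = k then lift k 0 u else .var (i - 1)) t := by
  have h : ∀ k, up (fun i => if i < k then .var i else
        if i = k then lift k 0 u else .var (i - 1)) =
      fun i => if i < k + 1 then .var i else
        if i = k + 1 then lift (k + 1) 0 u else .var (i - 1) := by
    intro k; funext i
    cases i with
    | zero => simp [up]
    | succ i =>
      rcases lt_trichotomy i k with hi | hi | hi
      · simp [up, hi, rename]
      · simp [up, hi, rename_succ_lift]
      · have h₁ : ¬ i < k := by omega
        have h₂ : i ≠ k := by omega
        simp only [up, h₁, h₂, if_false, rename, Nat.add_lt_add_iff_right,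
          Nat.add_right_cancel_iff]
        congr 1; omega
  induction t generalizing k with
  | var i => simp only [subst, inst]
  | _ => simp_all [subst, inst]

theorem subst_zero (u t : Tm) : subst u 0 t = inst (scons u Tm.var) t := by
  rw [subst_eq_inst]
  congr 1; funext i
  cases i <;> simp [scons, lift_zero_zero]

theorem inst_subst_zero (σ : ℕ → Tm) (u t : Tm) :
    inst σ (subst u 0 t) = subst (inst σ u) 0 (inst (up σ) t) := by
  rw [subst_zero, subst_zero, inst_inst, inst_inst]
  congr 1; funext i
  cases i with
  | zero => rfl
  | succ i =>
    have h : scons (inst σ u) Tm.var ∘ Nat.succ = Tm.var := rfl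
    simp only [Function.comp, scons, up, inst_rename]
    exact (h ▸ inst_var (σ i)).symm

theorem rename_subst_zero (ξ : ℕ → ℕ) (u t : Tm) :
    rename ξ (subst u 0 t) = subst (rename ξ u) 0 (rename (upRen ξ) t) := by
  have h : up (Tm.var ∘ ξ) = Tm.var ∘ upRen ξ := by funext i; cases i <;> rfl
  simp only [rename_eq_inst, inst_subst_zero, h]

theorem inst_scons_lift_succ (u : Tm) (σ : ℕ → Tm) (n : ℕ) (t : Tm) :
    inst (scons u σ) (lift (n + 1) 0 t) = inst σ (lift n 0 t) := by
  rw [← rename_succ_lift, inst_rename]; rfl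

/-! ### Parallel reduction and confluence -/

/-- Parallel reduction. -/
inductive Par : Tm → Tm → Prop
  | var (i : ℕ) : Par (.var i) (.var i)
  | sort (i : ℕ) : Par (.sort i) (.sort i)
  | pi {A A' B B'} : Par A A' → Par B B' → Par (.pi A B) (.pi A' B')
  | lam {A A' t t'} : Par A A' → Par t t' → Par (.lam A t) (.lam A' t')
  | app {t t' u u'} : Par t t' → Par u u' → Par (.app t u) (.app t' u')
  | beta (A : Tm) {t t' u u'} : Par t t' → Par u u' →
      Par (.app (.lam A t) u) (subst u' 0 t')

theorem Par.refl (t : Tm) : Par t t := by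
  induction t <;> constructor <;> assumption

theorem Par.inst {t t' : Tm} (h : Par t t') : ∀ {σ σ' : ℕ → Tm},
    (∀ i, Par (σ i) (σ' i)) → Par (inst σ t) (inst σ' t') := by
  have ren : ∀ {t t' : Tm}, Par t t' → ∀ ξ : ℕ → ℕ, Par (rename ξ t) (rename ξ t') := by
    intro t t' h
    induction h with
    | var | sort => intro ξ; exact Par.refl _
    | pi _ _ ih₁ ih₂ => intro ξ; exact .pi (ih₁ ξ) (ih₂ _)
    | lam _ _ ih₁ ih₂ => intro ξ; exact .lam (ih₁ ξ) (ih₂ _)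
    | app _ _ ih₁ ih₂ => intro ξ; exact .app (ih₁ ξ) (ih₂ _)
    | beta A _ _ ih₁ ih₂ =>
      intro ξ; rw [rename_subst_zero]; exact .beta _ (ih₁ _) (ih₂ ξ)
  have hup : ∀ {σ σ' : ℕ → Tm}, (∀ i, Par (σ i) (σ' i)) → ∀ i, Par (up σ i) (up σ' i) := by
    intro σ σ' h i
    cases i with
    | zero => exact Par.refl _
    | succ i => exact ren (h i) _
  induction h with
  | var i => intro σ σ' hσ; exact hσ i
  | sort => intro σ σ' _; exact Par.refl _
  | pi _ _ ih₁ ih₂ => intro σ σ' hσ; exact .pi (ih₁ hσ) (ih₂ (hup hσ))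
  | lam _ _ ih₁ ih₂ => intro σ σ' hσ; exact .lam (ih₁ hσ) (ih₂ (hup hσ))
  | app _ _ ih₁ ih₂ => intro σ σ' hσ; exact .app (ih₁ hσ) (ih₂ hσ)
  | beta A _ _ ih₁ ih₂ =>
    intro σ σ' hσ
    rw [inst_subst_zero]
    exact .beta _ (ih₁ (hup hσ)) (ih₂ hσ)

theorem Par.subst {t t' u u' : Tm} (ht : Par t t') (hu : Par u u') :
    Par (subst u 0 t) (subst u' 0 t') := by
  rw [subst_zero, subst_zero]
  refine ht.inst fun i => ?_
  cases i with
  | zero => exact hu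
  | succ i => exact Par.refl _

/-- Complete development. -/
def develop : Tm → Tm
  | .var i => .var i
  | .sort i => .sort i
  | .pi A B => .pi (develop A) (develop B)
  | .lam A t => .lam (develop A) (develop t)
  | .app (.lam _ t) u => subst (develop u) 0 (develop t)
  | .app t u => .app (develop t) (develop u)

theorem Par.triangle {t t' : Tm} (h : Par t t') : Par t' (develop t) := by
  induction h with
  | var | sort => exact Par.refl _
  | pi _ _ ih₁ ih₂ => exact .pi ih₁ ih₂
  | lam _ _ ih₁ ih₂ => exact .lam ih₁ ih₂
  | @app t t' u u' h₁ h₂ ih₁ ih₂ =>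
    cases t with
    | lam A b =>
      cases h₁ with
      | lam _ _ =>
        cases ih₁ with
        | lam _ hb => exact .beta _ hb ih₂
    | _ => exact .app ih₁ ih₂
  | beta A _ _ ih₁ ih₂ => exact ih₁.subst ih₂

namespace Reds

theorem trans {t u v : Tm} (h₁ : Reds t u) (h₂ : Reds u v) : Reds t v :=
  Relation.ReflTransGen.trans h₁ h₂

theorem pi {A A' B B' : Tm} (h₁ : Reds A A') (h₂ : Reds B B') :
    Reds (.pi A B) (.pi A' B') :=
  trans (Relation.ReflTransGen.lift (Tm.pi · B) (fun _ _ => Red.piDom B) _ _ h₁)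
    (Relation.ReflTransGen.lift (Tm.pi A') (fun _ _ => Red.piCod A') _ _ h₂)

theorem lam {A A' t t' : Tm} (h₁ : Reds A A') (h₂ : Reds t t') :
    Reds (.lam A t) (.lam A' t') :=
  trans (Relation.ReflTransGen.lift (Tm.lam · t) (fun _ _ => Red.lamDom t) _ _ h₁)
    (Relation.ReflTransGen.lift (Tm.lam A') (fun _ _ => Red.lamBody A') _ _ h₂)

theorem app {t t' u u' : Tm} (h₁ : Reds t t') (h₂ : Reds u u') :
    Reds (.app t u) (.app t' u') :=
  trans (Relation.ReflTransGen.lift (Tm.app · u) (fun _ _ => Red.appFun u) _ _ h₁)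
    (Relation.ReflTransGen.lift (Tm.app t') (fun _ _ => Red.appArg t') _ _ h₂)

theorem conv {t u : Tm} (h : Reds t u) : Conv t u := by
  induction h with
  | refl => exact .refl _
  | tail _ h ih => exact .trans _ _ _ ih (.rel _ _ h)

theorem eq_sort {i : ℕ} {t : Tm} (h : Reds (.sort i) t) : t = .sort i := by
  induction h with
  | refl => rfl
  | tail _ h ih => subst ih; cases h

theorem exists_pi {A B t : Tm} (h : Reds (.pi A B) t) :
    ∃ A' B', t = .pi A' B' ∧ Reds A A' ∧ Reds B B' := by
  induction h with
  | refl => exact ⟨A, B, rfl, .refl, .refl⟩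
  | tail _ h ih =>
    obtain ⟨A', B', rfl, hA, hB⟩ := ih
    cases h with
    | piDom _ h => exact ⟨_, _, rfl, hA.tail h, hB⟩
    | piCod _ h => exact ⟨_, _, rfl, hA, hB.tail h⟩

end Reds

theorem Red.par {t u : Tm} (h : Red t u) : Par t u := by
  induction h with
  | beta A t u => exact .beta A (Par.refl _) (Par.refl _)
  | piDom _ _ ih => exact .pi ih (Par.refl _)
  | piCod _ _ ih => exact .pi (Par.refl _) ih
  | lamDom _ _ ih => exact .lam ih (Par.refl _)
  | lamBody _ _ ih => exact .lam (Par.refl _) ih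
  | appFun _ _ ih => exact .app ih (Par.refl _)
  | appArg _ _ ih => exact .app (Par.refl _) ih

theorem Par.reds {t u : Tm} (h : Par t u) : Reds t u := by
  induction h with
  | var | sort => exact .refl
  | pi _ _ ih₁ ih₂ => exact .pi ih₁ ih₂
  | lam _ _ ih₁ ih₂ => exact .lam ih₁ ih₂
  | app _ _ ih₁ ih₂ => exact .app ih₁ ih₂
  | beta A _ _ ih₁ ih₂ =>
    exact ((Reds.lam .refl ih₁).app ih₂).tail (.beta A _ _)

theorem reds_iff_par {t u : Tm} : Reds t u ↔ Relation.ReflTransGen Par t u := by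
  refine ⟨fun h => Relation.ReflTransGen.mono (fun _ _ => Red.par) _ _ h, fun h => ?_⟩
  induction h with
  | refl => exact .refl
  | tail _ h ih => exact ih.trans h.reds

theorem Reds.confluent {t u v : Tm} (h₁ : Reds t u) (h₂ : Reds t v) :
    ∃ w, Reds u w ∧ Reds v w := by
  rw [reds_iff_par] at h₁ h₂
  obtain ⟨w, hu, hv⟩ := Relation.church_rosser
    (fun a b c hb hc => ⟨develop a, .single hb.triangle, .single hc.triangle⟩) h₁ h₂
  exact ⟨w, reds_iff_par.2 hu, reds_iff_par.2 hv⟩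

namespace Conv

theorem refl (t : Tm) : Conv t t := Relation.EqvGen.refl t

theorem symm {t u : Tm} (h : Conv t u) : Conv u t := Relation.EqvGen.symm _ _ h

theorem trans {t u v : Tm} (h₁ : Conv t u) (h₂ : Conv u v) : Conv t v :=
  Relation.EqvGen.trans _ _ _ h₁ h₂

theorem join {t u : Tm} (h : Conv t u) : ∃ w, Reds t w ∧ Reds u w := by
  induction h with
  | rel _ _ h => exact ⟨_, .single h, .refl⟩
  | refl => exact ⟨_, .refl, .refl⟩
  | symm _ _ _ ih => exact ih.imp fun _ h => h.symm
  | trans _ _ _ _ _ ih₁ ih₂ =>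
    obtain ⟨w₁, h₁, h₂⟩ := ih₁
    obtain ⟨w₂, h₃, h₄⟩ := ih₂
    obtain ⟨w, h₅, h₆⟩ := h₂.confluent h₃
    exact ⟨w, h₁.trans h₅, h₄.trans h₆⟩

theorem sort_inj {i j : ℕ} (h : Conv (.sort i) (.sort j)) : i = j := by
  obtain ⟨w, h₁, h₂⟩ := h.join
  exact Tm.sort.inj (h₁.eq_sort.symm.trans h₂.eq_sort)

theorem not_sort_pi {i : ℕ} {A B : Tm} : ¬ Conv (.sort i) (.pi A B) := by
  intro h
  obtain ⟨w, h₁, h₂⟩ := h.join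
  obtain ⟨A', B', h₂, -⟩ := h₂.exists_pi
  exact Tm.noConfusion (h₁.eq_sort.symm.trans h₂)

theorem pi_inj {A A' B B' : Tm} (h : Conv (.pi A B) (.pi A' B')) :
    Conv A A' ∧ Conv B B' := by
  obtain ⟨w, h₁, h₂⟩ := h.join
  obtain ⟨A₁, B₁, rfl, hA₁, hB₁⟩ := h₁.exists_pi
  obtain ⟨A₂, B₂, h, hA₂, hB₂⟩ := h₂.exists_pi
  cases h
  exact ⟨hA₁.conv.trans hA₂.conv.symm, hB₁.conv.trans hB₂.conv.symm⟩

theorem inst {t u : Tm} (h : Conv t u) (σ : ℕ → Tm) : Conv (inst σ t) (inst σ u) := by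
  induction h with
  | rel _ _ h => exact (h.par.inst fun i => Par.refl (σ i)).reds.conv
  | refl => exact refl _
  | symm _ _ _ ih => exact ih.symm
  | trans _ _ _ _ _ ih₁ ih₂ => exact ih₁.trans ih₂

end Conv

/-! ### Inversion of cumulativity -/

theorem Cum.inst {t u : Tm} (h : Cum t u) (σ : ℕ → Tm) : Cum (inst σ t) (inst σ u) := by
  induction h generalizing σ with
  | ofConv h => exact .ofConv (h.inst σ)
  | sort h => exact .sort h
  | pi h _ ih => exact .pi (h.inst σ) (ih _)
  | trans _ _ ih₁ ih₂ => exact .trans (ih₁ σ) (ih₂ σ)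

theorem Cum.rename {t u : Tm} (h : Cum t u) (ξ : ℕ → ℕ) :
    Cum (rename ξ t) (rename ξ u) := by
  simpa only [rename_eq_inst] using h.inst _

theorem Cum.refl (t : Tm) : Cum t t := .ofConv (.refl t)

/-- Transitivity-free presentation of cumulativity. -/
inductive CumHead : Tm → Tm → Prop
  | ofConv {t u} : Conv t u → CumHead t u
  | sort {t u : Tm} {i j : ℕ} : Conv t (.sort i) → Conv (.sort j) u → i ≤ j → CumHead t u
  | pi {t u A A' B B' : Tm} : Conv t (.pi A B) → Conv (.pi A' B') u → Conv A A' →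
      CumHead B B' → CumHead t u

namespace CumHead

theorem conv_left {t u v : Tm} (h : Conv t u) (h' : CumHead u v) : CumHead t v := by
  cases h' with
  | ofConv h₁ => exact .ofConv (h.trans h₁)
  | sort h₁ h₂ hij => exact .sort (h.trans h₁) h₂ hij
  | pi h₁ h₂ hA hB => exact .pi (h.trans h₁) h₂ hA hB

theorem conv_right {t u v : Tm} (h : CumHead t u) (h' : Conv u v) : CumHead t v := by
  cases h with
  | ofConv h₁ => exact .ofConv (h₁.trans h')
  | sort h₁ h₂ hij => exact .sort h₁ (h₂.trans h') hij
  | pi h₁ h₂ hA hB => exact .pi h₁ (h₂.trans h') hA hB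

theorem trans {t u v : Tm} (h : CumHead t u) (h' : CumHead u v) : CumHead t v := by
  induction h generalizing v with
  | ofConv h => exact h'.conv_left h
  | sort h₁ h₂ hij =>
    cases h' with
    | ofConv h => exact .sort h₁ (h₂.trans h) hij
    | sort h₃ h₄ hkl =>
      have := (h₂.trans h₃).sort_inj
      exact .sort h₁ h₄ (by omega)
    | pi h₃ => exact (Conv.not_sort_pi (h₂.trans h₃)).elim
  | pi h₁ h₂ hA _ ih =>
    cases h' with
    | ofConv h => exact .pi h₁ (h₂.trans h) hA ‹_›
    | sort h₃ => exact (Conv.not_sort_pi (h₂.trans h₃).symm).elim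
    | pi h₃ h₄ hA' hB' =>
      obtain ⟨hA'', hB''⟩ := (h₂.trans h₃).pi_inj
      exact .pi h₁ h₄ ((hA.trans hA'').trans hA') (ih (hB'.conv_left hB''))

theorem cum {t u : Tm} (h : CumHead t u) : Cum t u := by
  induction h with
  | ofConv h => exact .ofConv h
  | sort h₁ h₂ h => exact (Cum.ofConv h₁).trans ((Cum.sort h).trans (.ofConv h₂))
  | pi h₁ h₂ hA _ ih => exact (Cum.ofConv h₁).trans ((Cum.pi hA ih).trans (.ofConv h₂))

end CumHead

namespace Cum

theorem cumHead {t u : Tm} (h : Cum t u) : CumHead t u := by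
  induction h with
  | ofConv h => exact .ofConv h
  | sort h => exact .sort (.refl _) (.refl _) h
  | pi h _ ih => exact .pi (.refl _) (.refl _) h ih
  | trans _ _ ih₁ ih₂ => exact ih₁.trans ih₂

theorem sort_le {i j : ℕ} (h : Cum (.sort i) (.sort j)) : i ≤ j := by
  cases h.cumHead with
  | ofConv h => exact h.sort_inj.le
  | sort h₁ h₂ h => rw [h₁.sort_inj, ← h₂.sort_inj]; exact h
  | pi h => exact (Conv.not_sort_pi h).elim

theorem pi_inj {A A' B B' : Tm} (h : Cum (.pi A B) (.pi A' B')) :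
    Conv A A' ∧ Cum B B' := by
  cases h.cumHead with
  | ofConv h => exact ⟨h.pi_inj.1, .ofConv h.pi_inj.2⟩
  | sort h => exact (Conv.not_sort_pi h.symm).elim
  | pi h₁ h₂ hA hB =>
    exact ⟨(h₁.pi_inj.1.trans hA).trans h₂.pi_inj.1,
      ((hB.conv_left h₁.pi_inj.2).conv_right h₂.pi_inj.2).cum⟩

theorem subst {B B' : Tm} (h : Cum B B') (u : Tm) :
    Cum (subst u 0 B) (subst u 0 B') := by
  simpa only [subst_zero] using h.inst _

end Cum

theorem Red.conv {t u : Tm} (h : Red t u) : Conv t u := .rel _ _ h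

theorem Conv.subst_arg {u u' : Tm} (h : Red u u') (B : Tm) :
    Conv (subst u 0 B) (subst u' 0 B) :=
  ((Par.refl B).subst h.par).reds.conv

/-! ### Metatheory of cumulative undirected typing -/

namespace TypedC

/-- Induction on typing derivations, ignoring context well-formedness derivations. -/
@[elab_as_elim]
theorem induct {motive : ∀ {Γ t T}, TypedC Γ t T → Prop}
    (sort : ∀ {Γ i} (hΓ : WfCtxC Γ), motive (TypedC.sort (i := i) hΓ))
    (var : ∀ {Γ n A} (hΓ : WfCtxC Γ) (hA : Γ[n]? = some A), motive (TypedC.var hΓ hA))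
    (pi : ∀ {Γ A B i j} (hA : TypedC Γ A (.sort i)) (hB : TypedC (A :: Γ) B (.sort j)),
      motive hA → motive hB → motive (TypedC.pi hA hB))
    (lam : ∀ {Γ A B t i} (hP : TypedC Γ (.pi A B) (.sort i)) (ht : TypedC (A :: Γ) t B),
      motive hP → motive ht → motive (TypedC.lam hP ht))
    (app : ∀ {Γ t u A B} (ht : TypedC Γ t (.pi A B)) (hu : TypedC Γ u A),
      motive ht → motive hu → motive (TypedC.app ht hu))
    (cumul : ∀ {Γ t A B i} (ht : TypedC Γ t A) (hB : TypedC Γ B (.sort i)) (hc : Cum A B),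
      motive ht → motive hB → motive (TypedC.cumul ht hB hc))
    {Γ : Ctx} {t T : Tm} (h : TypedC Γ t T) : motive h :=
  TypedC.rec (motive_1 := fun _ _ => True) (motive_2 := fun _ _ _ h => motive h)
    trivial (fun _ _ _ _ => trivial) (fun h _ => sort h) (fun h h' _ => var h h')
    pi lam app cumul h

theorem wfCtx {Γ : Ctx} {t T : Tm} (h : TypedC Γ t T) : WfCtxC Γ := by
  induction h using induct <;> assumption

theorem inv_sort {Γ : Ctx} {i : ℕ} {T : Tm} (h : TypedC Γ (.sort i) T) :
    Cum (.sort (i + 1)) T := by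
  generalize ht : Tm.sort i = t at h
  induction h using induct with
  | sort => cases ht; exact .refl _
  | cumul _ _ h ih => exact (ih ht).trans h
  | _ => cases ht

theorem inv_var {Γ : Ctx} {n : ℕ} {T : Tm} (h : TypedC Γ (.var n) T) :
    ∃ A, Γ[n]? = some A ∧ Cum (lift (n + 1) 0 A) T := by
  generalize ht : Tm.var n = t at h
  induction h using induct with
  | var _ h => cases ht; exact ⟨_, h, .refl _⟩
  | cumul _ _ h ih =>
    obtain ⟨A, hA, hc⟩ := ih ht
    exact ⟨A, hA, hc.trans h⟩
  | _ => cases ht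

theorem inv_pi {Γ : Ctx} {A B T : Tm} (h : TypedC Γ (.pi A B) T) :
    ∃ i j, TypedC Γ A (.sort i) ∧ TypedC (A :: Γ) B (.sort j) ∧
      Cum (.sort (max i j)) T := by
  generalize ht : Tm.pi A B = t at h
  induction h using induct with
  | pi hA hB => cases ht; exact ⟨_, _, hA, hB, .refl _⟩
  | cumul _ _ h ih =>
    obtain ⟨i, j, hA, hB, hc⟩ := ih ht
    exact ⟨i, j, hA, hB, hc.trans h⟩
  | _ => cases ht

theorem inv_lam {Γ : Ctx} {A t T : Tm} (h : TypedC Γ (.lam A t) T) :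
    ∃ B i, TypedC Γ (.pi A B) (.sort i) ∧ TypedC (A :: Γ) t B ∧ Cum (.pi A B) T := by
  generalize hs : Tm.lam A t = s at h
  induction h using induct with
  | lam hP ht => cases hs; exact ⟨_, _, hP, ht, .refl _⟩
  | cumul _ _ h ih =>
    obtain ⟨B, i, hP, ht, hc⟩ := ih hs
    exact ⟨B, i, hP, ht, hc.trans h⟩
  | _ => cases hs

theorem inv_app {Γ : Ctx} {t u T : Tm} (h : TypedC Γ (.app t u) T) :
    ∃ A B, TypedC Γ t (.pi A B) ∧ TypedC Γ u A ∧ Cum (CComega.subst u 0 B) T := by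
  generalize hs : Tm.app t u = s at h
  induction h using induct with
  | app ht hu => cases hs; exact ⟨_, _, ht, hu, .refl _⟩
  | cumul _ _ h ih =>
    obtain ⟨A, B, ht, hu, hc⟩ := ih hs
    exact ⟨A, B, ht, hu, hc.trans h⟩
  | _ => cases hs

/-- `ξ` maps the declarations of `Γ` to declarations of `Δ`. -/
def IsRenaming (ξ : ℕ → ℕ) (Γ Δ : Ctx) : Prop :=
  ∀ n A, Γ[n]? = some A →
    ∃ B, Δ[ξ n]? = some B ∧ lift (ξ n + 1) 0 B = CComega.rename ξ (lift (n + 1) 0 A)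

theorem IsRenaming.up {ξ : ℕ → ℕ} {Γ Δ : Ctx} (h : IsRenaming ξ Γ Δ) (A : Tm) :
    IsRenaming (upRen ξ) (A :: Γ) (CComega.rename ξ A :: Δ) := by
  intro n C hC
  cases n with
  | zero =>
    cases hC
    refine ⟨_, rfl, ?_⟩
    rw [rename_upRen_lift_succ, lift_zero_zero, lift_zero_eq_rename]; rfl
  | succ n =>
    obtain ⟨B, hB, hl⟩ := h n C hC
    refine ⟨B, hB, ?_⟩
    rw [rename_upRen_lift_succ, ← hl, rename_succ_lift]; rfl

theorem isRenaming_succ (A : Tm) (Γ : Ctx) : IsRenaming Nat.succ Γ (A :: Γ) := by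
  intro n C hC
  exact ⟨C, hC, (rename_succ_lift _ _).symm⟩

theorem rename {Γ : Ctx} {t T : Tm} (h : TypedC Γ t T) :
    ∀ {ξ : ℕ → ℕ} {Δ : Ctx}, WfCtxC Δ → IsRenaming ξ Γ Δ →
      TypedC Δ (rename ξ t) (rename ξ T) := by
  induction h using induct with
  | sort => intro ξ Δ hΔ _; exact .sort hΔ
  | var _ h =>
    intro ξ Δ hΔ hξ
    obtain ⟨B, hB, hl⟩ := hξ _ _ h
    rw [← hl]
    exact .var hΔ hB
  | pi _ _ ihA ihB =>
    intro ξ Δ hΔ hξ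
    have hA := ihA hΔ hξ
    exact .pi hA (ihB (.cons hΔ hA) (hξ.up _))
  | lam _ _ ihP iht =>
    intro ξ Δ hΔ hξ
    have hP := ihP hΔ hξ
    obtain ⟨i, j, hA, -⟩ := hP.inv_pi
    exact .lam hP (iht (.cons hΔ hA) (hξ.up _))
  | app _ _ iht ihu =>
    intro ξ Δ hΔ hξ
    rw [rename_subst_zero]
    exact .app (iht hΔ hξ) (ihu hΔ hξ)
  | cumul _ _ hc ih₁ ih₂ =>
    intro ξ Δ hΔ hξ
    exact .cumul (ih₁ hΔ hξ) (ih₂ hΔ hξ) (hc.rename ξ)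

theorem weaken {Γ : Ctx} {t T A : Tm} (h : TypedC Γ t T) (hA : WfCtxC (A :: Γ)) :
    TypedC (A :: Γ) (CComega.rename Nat.succ t) (CComega.rename Nat.succ T) :=
  h.rename hA (isRenaming_succ A Γ)

/-- `σ` is a well-typed substitution from `Γ` to `Δ`. -/
def IsSubst (σ : ℕ → Tm) (Γ Δ : Ctx) : Prop :=
  ∀ n A, Γ[n]? = some A → TypedC Δ (σ n) (CComega.inst σ (lift (n + 1) 0 A))

theorem IsSubst.up {σ : ℕ → Tm} {Γ Δ : Ctx} {A : Tm} (h : IsSubst σ Γ Δ)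
    (hA : WfCtxC (CComega.inst σ A :: Δ)) :
    IsSubst (up σ) (A :: Γ) (CComega.inst σ A :: Δ) := by
  intro n C hC
  rw [inst_up_lift_succ]
  cases n with
  | zero =>
    cases hC
    have := TypedC.var (n := 0) hA rfl
    rw [← rename_succ_lift, lift_zero_zero] at this
    rwa [lift_zero_zero]
  | succ n => exact (h n C hC).weaken hA

theorem inst {Γ : Ctx} {t T : Tm} (h : TypedC Γ t T) :
    ∀ {σ : ℕ → Tm} {Δ : Ctx}, WfCtxC Δ → IsSubst σ Γ Δ →
      TypedC Δ (inst σ t) (inst σ T) := by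
  induction h using induct with
  | sort => intro σ Δ hΔ _; exact .sort hΔ
  | var _ h => intro σ Δ hΔ hσ; exact hσ _ _ h
  | pi _ _ ihA ihB =>
    intro σ Δ hΔ hσ
    have hA := ihA hΔ hσ
    exact .pi hA (ihB (.cons hΔ hA) (hσ.up (.cons hΔ hA)))
  | lam _ _ ihP iht =>
    intro σ Δ hΔ hσ
    have hP := ihP hΔ hσ
    obtain ⟨i, j, hA, -⟩ := hP.inv_pi
    exact .lam hP (iht (.cons hΔ hA) (hσ.up (.cons hΔ hA)))
  | app _ _ iht ihu =>
    intro σ Δ hΔ hσ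
    rw [inst_subst_zero]
    exact .app (iht hΔ hσ) (ihu hΔ hσ)
  | cumul _ _ hc ih₁ ih₂ =>
    intro σ Δ hΔ hσ
    exact .cumul (ih₁ hΔ hσ) (ih₂ hΔ hσ) (hc.inst σ)

theorem subst {Γ : Ctx} {t u A B : Tm} (ht : TypedC (A :: Γ) t B) (hu : TypedC Γ u A) :
    TypedC Γ (subst u 0 t) (subst u 0 B) := by
  rw [subst_zero, subst_zero]
  refine ht.inst hu.wfCtx fun n C hC => ?_
  rw [inst_scons_lift_succ, inst_var]
  cases n with
  | zero => cases hC; rwa [lift_zero_zero]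
  | succ n => exact .var hu.wfCtx hC

theorem ctx_conv {Γ : Ctx} {A A' t T : Tm} {i j : ℕ} (h : TypedC (A :: Γ) t T)
    (hA : TypedC Γ A (.sort i)) (hA' : TypedC Γ A' (.sort j)) (hc : Conv A A') :
    TypedC (A' :: Γ) t T := by
  have hΓ' : WfCtxC (A' :: Γ) := .cons hA'.wfCtx hA'
  rw [← inst_var t, ← inst_var T]
  refine h.inst hΓ' fun n C hC => ?_
  rw [inst_var]
  cases n with
  | zero =>
    cases hC
    have h₀ := TypedC.var (n := 0) hΓ' rfl
    rw [← rename_succ_lift, lift_zero_zero] at h₀ ⊢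
    exact .cumul h₀ (hA.weaken hΓ') ((Cum.ofConv hc.symm).rename _)
  | succ n => exact .var hΓ' hC

theorem _root_.CComega.WfCtxC.typed_lookup {Γ : Ctx} (hΓ : WfCtxC Γ) {n : ℕ} {A : Tm}
    (h : Γ[n]? = some A) : ∃ i, TypedC Γ (lift (n + 1) 0 A) (.sort i) := by
  induction Γ generalizing n with
  | nil => cases h
  | cons C Γ ih =>
    have hΓ' := hΓ
    obtain _ | ⟨hΓ', hC⟩ := hΓ'
    rw [← rename_succ_lift]
    cases n with
    | zero =>
      cases h
      rw [lift_zero_zero]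
      exact ⟨_, hC.weaken hΓ⟩
    | succ n =>
      obtain ⟨i, hi⟩ := ih hΓ' h
      exact ⟨i, hi.weaken hΓ⟩

theorem type_typed {Γ : Ctx} {t T : Tm} (h : TypedC Γ t T) :
    ∃ i, TypedC Γ T (.sort i) := by
  induction h using induct with
  | sort h => exact ⟨_, .sort h⟩
  | var hΓ h => exact hΓ.typed_lookup h
  | pi h => exact ⟨_, .sort h.wfCtx⟩
  | lam h => exact ⟨_, h⟩
  | app _ hu ih =>
    obtain ⟨_, hP⟩ := ih
    obtain ⟨_, j, _, hB, _⟩ := hP.inv_pi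
    exact ⟨j, hB.subst hu⟩
  | cumul _ h => exact ⟨_, h⟩

theorem red {t t' : Tm} (hr : Red t t') :
    ∀ {Γ : Ctx} {T : Tm}, TypedC Γ t T → TypedC Γ t' T := by
  induction hr with
  | beta A t u =>
    intro Γ T h
    obtain ⟨_, hT⟩ := h.type_typed
    obtain ⟨A', B', hl, hu, hc⟩ := h.inv_app
    obtain ⟨B, _, hP, ht, hc'⟩ := hl.inv_lam
    obtain ⟨_, _, hA, _, _⟩ := hP.inv_pi
    obtain ⟨hcA, hcB⟩ := hc'.pi_inj
    have hu' : TypedC Γ u A := .cumul hu hA (.ofConv hcA.symm)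
    exact .cumul (ht.subst hu') hT ((hcB.subst u).trans hc)
  | piDom B hr ih =>
    intro Γ T h
    obtain ⟨_, hT⟩ := h.type_typed
    obtain ⟨_, _, hA, hB, hc⟩ := h.inv_pi
    exact .cumul (.pi (ih hA) (hB.ctx_conv hA (ih hA) hr.conv)) hT hc
  | piCod A hr ih =>
    intro Γ T h
    obtain ⟨_, hT⟩ := h.type_typed
    obtain ⟨_, _, hA, hB, hc⟩ := h.inv_pi
    exact .cumul (.pi hA (ih hB)) hT hc
  | lamDom t hr ih =>
    intro Γ T h
    obtain ⟨_, hT⟩ := h.type_typed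
    obtain ⟨B, _, hP, ht, hc⟩ := h.inv_lam
    obtain ⟨_, _, hA, hB, _⟩ := hP.inv_pi
    have hB' := hB.ctx_conv hA (ih hA) hr.conv
    have ht' := ht.ctx_conv hA (ih hA) hr.conv
    exact .cumul (.lam (.pi (ih hA) hB') ht') hT
      ((Cum.pi hr.conv.symm (.refl B)).trans hc)
  | lamBody A hr ih =>
    intro Γ T h
    obtain ⟨_, hT⟩ := h.type_typed
    obtain ⟨B, _, hP, ht, hc⟩ := h.inv_lam
    exact .cumul (.lam hP (ih ht)) hT hc
  | appFun u hr ih =>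
    intro Γ T h
    obtain ⟨_, hT⟩ := h.type_typed
    obtain ⟨A, B, ht, hu, hc⟩ := h.inv_app
    exact .cumul (.app (ih ht) hu) hT hc
  | appArg t hr ih =>
    intro Γ T h
    obtain ⟨_, hT⟩ := h.type_typed
    obtain ⟨A, B, ht, hu, hc⟩ := h.inv_app
    exact .cumul (.app ht (ih hu)) hT
      ((Cum.ofConv (Conv.subst_arg hr B).symm).trans hc)

theorem reds {Γ : Ctx} {t t' T : Tm} (h : TypedC Γ t T) (hr : Reds t t') :
    TypedC Γ t' T := by
  induction hr with
  | refl => exact h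
  | tail _ hr ih => exact ih.red hr

end TypedC

/-! ### Soundness and principality of cumulative inference -/

namespace InferC

/-- Induction on inference derivations, with the other judgements unfolded. -/
@[elab_as_elim]
theorem induct {motive : ∀ {Γ t T}, InferC Γ t T → Prop}
    (sort : ∀ {Γ i}, motive (InferC.sort (Γ := Γ) (i := i)))
    (var : ∀ {Γ n A} (h : Γ[n]? = some A), motive (InferC.var h))
    (pi : ∀ {Γ A B S S' i j} {hA : InferC Γ A S} {hB : InferC (A :: Γ) B S'}
      (hS : Reds S (.sort i)) (hS' : Reds S' (.sort j)), motive hA → motive hB →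
      motive (InferC.pi (.inferSort hA hS) (.inferSort hB hS')))
    (lam : ∀ {Γ A t B S i} {hA : InferC Γ A S} {ht : InferC (A :: Γ) t B}
      (hS : Reds S (.sort i)), motive hA → motive ht →
      motive (InferC.lam (.inferSort hA hS) ht))
    (app : ∀ {Γ t u A A' B P} {ht : InferC Γ t P} {hu : InferC Γ u A'}
      (hP : Reds P (.pi A B)) (hc : Cum A' A), motive ht → motive hu →
      motive (InferC.app (.inferPi ht hP) (.check hu hc)))
    {Γ : Ctx} {t T : Tm} (h : InferC Γ t T) : motive h := by
  refine InferC.rec (motive_1 := fun _ _ _ h => motive h)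
    (motive_2 := fun Γ t T _ => ∃ T', ∃ h : InferC Γ t T', Cum T' T ∧ motive h)
    (motive_3 := fun Γ t T _ => ∃ T', ∃ h : InferC Γ t T', Reds T' T ∧ motive h)
    (motive_4 := fun Γ t T _ => ∃ T', ∃ h : InferC Γ t T', Reds T' T ∧ motive h)
    sort var ?_ ?_ ?_ (fun h hc ih => ⟨_, h, hc, ih⟩) (fun h hr ih => ⟨_, h, hr, ih⟩)
    (fun h hr ih => ⟨_, h, hr, ih⟩) h
  · rintro Γ A B i j - - ⟨S, _, hS, hA⟩ ⟨S', _, hS', hB⟩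
    exact pi hS hS' hA hB
  · rintro Γ A t B i - _ ⟨S, _, hS, hA⟩ ht
    exact lam hS hA ht
  · rintro Γ t u A B - - ⟨P, _, hP, ht⟩ ⟨A', _, hA, hu⟩
    exact app hP hA ht hu

theorem sound {Γ : Ctx} {t T : Tm} (h : InferC Γ t T) : WfCtxC Γ → TypedC Γ t T := by
  have to_sort : ∀ {Γ : Ctx} {A S : Tm} {i : ℕ}, WfCtxC Γ → TypedC Γ A S →
      Reds S (.sort i) → TypedC Γ A (.sort i) := fun hΓ hA hS =>
    .cumul hA (.sort hΓ) (.ofConv hS.conv)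
  induction h using induct with
  | sort => exact .sort
  | var h => exact fun hΓ => .var hΓ h
  | pi hS hS' ihA ihB =>
    intro hΓ
    have hA := to_sort hΓ (ihA hΓ) hS
    have hΓ' := WfCtxC.cons hΓ hA
    exact .pi hA (to_sort hΓ' (ihB hΓ') hS')
  | lam hS ihA iht =>
    intro hΓ
    have hA := to_sort hΓ (ihA hΓ) hS
    have ht := iht (.cons hΓ hA)
    obtain ⟨_, hB⟩ := ht.type_typed
    exact .lam (.pi hA hB) ht
  | app hP hc iht ihu =>
    intro hΓ
    have ht := iht hΓ
    obtain ⟨_, hT⟩ := ht.type_typed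
    have hPi := hT.reds hP
    obtain ⟨_, _, hA, _, _⟩ := hPi.inv_pi
    exact .app (.cumul ht hPi (.ofConv hP.conv)) (.cumul (ihu hΓ) hA hc)

theorem cum_of_typed {Γ : Ctx} {t T : Tm} (h : InferC Γ t T) :
    ∀ {T'}, TypedC Γ t T' → Cum T T' := by
  induction h using induct with
  | sort => exact TypedC.inv_sort
  | var h =>
    intro T' h'
    obtain ⟨A, hA, hc⟩ := h'.inv_var
    cases h.symm.trans hA
    exact hc
  | pi hS hS' ihA ihB =>
    intro T' h'
    obtain ⟨i, j, hA, hB, hc⟩ := h'.inv_pi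
    have hi := ((Cum.ofConv hS.conv.symm).trans (ihA hA)).sort_le
    have hj := ((Cum.ofConv hS'.conv.symm).trans (ihB hB)).sort_le
    exact (Cum.sort (max_le_max hi hj)).trans hc
  | lam _ _ iht =>
    intro T' h'
    obtain ⟨B', _, _, ht, hc⟩ := h'.inv_lam
    exact (Cum.pi (.refl _) (iht ht)).trans hc
  | app hP _ iht _ =>
    intro T' h'
    obtain ⟨A', B', ht, _, hc⟩ := h'.inv_app
    obtain ⟨_, hB⟩ := ((Cum.ofConv hP.conv.symm).trans (iht ht)).pi_inj
    exact (hB.subst _).trans hc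

end InferC

/-- **Inferred types are principal.** If `⊢ Γ` and `Γ ⊢ t ▹ T` in the
cumulative bidirectional system, then `T` is a principal type for `t` in `Γ`. -/
theorem inferred_principal {Γ : Ctx} {t T : Tm} (hΓ : WfCtxC Γ)
    (h : InferC Γ t T) :
    TypedC Γ t T ∧ ∀ T', TypedC Γ t T' → Cum T T' :=
  ⟨h.sound hΓ, fun _ => h.cum_of_typed⟩

end CComega
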